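/- arXiv:2009.04928 — 2 statements merged into one kernel-verified Lean document; each statement's English description precedes it below -/
import Mathlib

section
/- (Rees) Let y₁, ..., y_k be a regular sequence in a commutative ring R and let J = ⟨y₁, ..., y_k⟩ be a proper ideal. Then the associated graded ring of the J-adic filtration satisfies gr_J(R) ≅ (R/J)[t₁, ..., t_k], a polynomial ring over R/J, with t_i corresponding to the image of y_i in J/J². -/
open Polynomial

variable {R : Type*} [CommRing R]

/-- The degree-one element `a·X` of the Rees algebra `R[Jt]` attached to
`a ∈ J`; in the associated graded `gr_J(R) = R[Jt]/J·R[Jt]` it becomes the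
image of `a` in `J/J²`. -/
noncomputable def reesDegOne (J : Ideal R) (a : R) (ha : a ∈ J) : reesAlgebra J :=
  ⟨Polynomial.C a * Polynomial.X, by
    rw [mem_reesAlgebra_iff]
    intro i
    rcases eq_or_ne i 1 with h | h
    · subst h
      simpa [coeff_C_mul, coeff_X] using ha
    · simp [coeff_C_mul, coeff_X, h, Ne.symm h]⟩

/-- The associated graded ring `gr_J(R) = ⊕_{n≥0} Jⁿ/Jⁿ⁺¹`, realized as the
quotient of the Rees algebra `R[Jt] = ⊕ Jⁿ tⁿ` by the ideal `J·R[Jt]`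
(whose degree-`n` piece is `J^{n+1} tⁿ`). -/
abbrev assocGraded (J : Ideal R) :=
  (reesAlgebra J) ⧸ (J.map (algebraMap R (reesAlgebra J)))

namespace MvPolynomial

variable {σ : Type*}

theorem IsHomogeneous.eval_mem_mul_pow {y : σ → R} {s : Set σ} {n : ℕ} {F : MvPolynomial σ R}
    (hF : F.IsHomogeneous n) (hFs : F ∈ supported R s) {K : Ideal R}
    (hFK : F ∈ K.map (C : R →+* MvPolynomial σ R)) :
    eval y F ∈ K * Ideal.span (y '' s) ^ n := by
  rw [mem_map_C_iff] at hFK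
  rw [eval_eq]
  refine sum_mem fun u hu ↦ Ideal.mul_mem_mul (hFK u) ?_
  rw [hF.degree_eq_sum_deg_support hu, ← Finset.prod_pow_eq_pow_sum]
  refine Ideal.prod_mem_prod fun i hi ↦ Ideal.pow_mem_pow ?_ _
  refine Ideal.subset_span (Set.mem_image_of_mem y ?_)
  exact mem_supported.1 hFs ((mem_vars_iff_mem_support i).2 ⟨u, hu, hi⟩)

theorem IsHomogeneous.eval_mem_pow {y : σ → R} {s : Set σ} {n : ℕ} {F : MvPolynomial σ R}
    (hF : F.IsHomogeneous n) (hFs : F ∈ supported R s) :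
    eval y F ∈ Ideal.span (y '' s) ^ n := by
  simpa using hF.eval_mem_mul_pow (y := y) hFs (K := ⊤) (by simp [mem_map_C_iff])

/-- Every form of degree `d` in the variables indexed by `s` that vanishes at `y` has all its
coefficients in the ideal generated by the `y i` with `i ∈ s`. -/
def QuasiRegularOn (y : σ → R) (s : Set σ) (d : ℕ) : Prop :=
  ∀ F ∈ supported R s, F.IsHomogeneous d → eval y F = 0 →
    F ∈ (Ideal.span (y '' s)).map (C : R →+* MvPolynomial σ R)

theorem exists_form_of_mem_span_pow {y : σ → R} {s : Set σ} {n : ℕ} {x : R}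
    (hx : x ∈ Ideal.span (y '' s) ^ n) :
    ∃ F ∈ supported R s, F.IsHomogeneous n ∧ eval y F = x := by
  rw [Set.image_eq_range, Ideal.mem_span_pow_iff_exists_isHomogeneous] at hx
  obtain ⟨p, hp, rfl⟩ := hx
  refine ⟨rename (↑) p, ?_, hp.rename_isHomogeneous, ?_⟩
  · rw [supported_eq_range_rename]
    exact ⟨p, rfl⟩
  · rw [eval_rename]
    rfl

theorem exists_form_of_mem_span_pow_succ {y : σ → R} {s : Set σ} {n : ℕ} {x : R}
    (hx : x ∈ Ideal.span (y '' s) ^ (n + 1)) :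
    ∃ F ∈ supported R s, F.IsHomogeneous n ∧
      F ∈ (Ideal.span (y '' s)).map (C : R →+* MvPolynomial σ R) ∧ eval y F = x := by
  rw [pow_succ'] at hx
  induction hx using Submodule.mul_induction_on' with
  | mem_mul_mem a ha b hb =>
    obtain ⟨F, hs, hF, rfl⟩ := exists_form_of_mem_span_pow hb
    refine ⟨C a * F, mul_mem (Subalgebra.algebraMap_mem _ a) hs, hF.C_mul a,
      Ideal.mul_mem_right _ _ (Ideal.mem_map_of_mem _ ha), by simp⟩
  | add a _ b _ ha hb =>
    obtain ⟨F, hFs, hF, hFI, rfl⟩ := ha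
    obtain ⟨G, hGs, hG, hGI, rfl⟩ := hb
    exact ⟨F + G, add_mem hFs hGs, hF.add hG, add_mem hFI hGI, by simp⟩

theorem QuasiRegularOn.mem_map_C {y : σ → R} {s : Set σ} {d : ℕ} (h : QuasiRegularOn y s d)
    {F : MvPolynomial σ R} (hFs : F ∈ supported R s) (hF : F.IsHomogeneous d)
    (hy : eval y F ∈ Ideal.span (y '' s) ^ (d + 1)) :
    F ∈ (Ideal.span (y '' s)).map (C : R →+* MvPolynomial σ R) := by
  obtain ⟨G, hGs, hG, hGI, hGy⟩ := exists_form_of_mem_span_pow_succ hy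
  have := h (F - G) (sub_mem hFs hGs) (hF.sub hG) (by simp [hGy])
  simpa using add_mem this hGI

theorem mem_span_pow_of_mul_mem {y : σ → R} {s : Set σ} (h : ∀ d, QuasiRegularOn y s d) {z : R}
    (hz : ∀ x, z * x ∈ Ideal.span (y '' s) → x ∈ Ideal.span (y '' s)) {n : ℕ} {x : R}
    (hx : z * x ∈ Ideal.span (y '' s) ^ n) : x ∈ Ideal.span (y '' s) ^ n := by
  induction n with
  | zero => simp
  | succ n ih =>
    obtain ⟨F, hFs, hF, rfl⟩ :=
      exists_form_of_mem_span_pow (ih (Ideal.pow_le_pow_right n.le_succ hx))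
    have hzF := (h n).mem_map_C (F := C z * F) (mul_mem (Subalgebra.algebraMap_mem _ z) hFs)
      (hF.C_mul z) (by simpa using hx)
    have hF' : F ∈ (Ideal.span (y '' s)).map (C : R →+* MvPolynomial σ R) := by
      rw [mem_map_C_iff] at hzF ⊢
      exact fun u ↦ hz _ (by simpa using hzF u)
    rw [pow_succ']
    exact hF.eval_mem_mul_pow hFs hF'

theorem IsHomogeneous.divMonomial_single {F : MvPolynomial σ R} {n : ℕ}
    (hF : F.IsHomogeneous (n + 1)) (a : σ) :
    (F.divMonomial (Finsupp.single a 1)).IsHomogeneous n := by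
  intro u hu
  rw [coeff_divMonomial] at hu
  have := hF hu
  rw [map_add, Finsupp.weight_single] at this
  simp only [Pi.one_apply, smul_eq_mul, mul_one] at this
  omega

theorem IsHomogeneous.modMonomial {F : MvPolynomial σ R} {n : ℕ} (hF : F.IsHomogeneous n)
    (v : σ →₀ ℕ) : (F.modMonomial v).IsHomogeneous n := by
  intro u hu
  by_cases h : v ≤ u
  · exact absurd (coeff_modMonomial_of_le F h) hu
  · exact hF (by rwa [coeff_modMonomial_of_not_le F h] at hu)

theorem divMonomial_mem_supported {F : MvPolynomial σ R} {s : Set σ} (hF : F ∈ supported R s)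
    (v : σ →₀ ℕ) : F.divMonomial v ∈ supported R s := by
  rw [mem_supported] at hF ⊢
  intro i hi
  obtain ⟨u, hu, hiu⟩ := (mem_vars_iff_mem_support i).1 hi
  refine hF ((mem_vars_iff_mem_support i).2 ⟨v + u, ?_, ?_⟩)
  · simpa [coeff_divMonomial] using hu
  · simp only [Finsupp.mem_support_iff, Finsupp.add_apply] at hiu ⊢
    omega

theorem modMonomial_single_mem_supported {F : MvPolynomial σ R} {s : Set σ} {a : σ}
    (hF : F ∈ supported R (insert a s)) :
    F.modMonomial (Finsupp.single a 1) ∈ supported R s := by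
  rw [mem_supported] at hF ⊢
  intro i hi
  obtain ⟨u, hu, hiu⟩ := (mem_vars_iff_mem_support i).1 hi
  have hau : ¬ Finsupp.single a 1 ≤ u := fun h ↦
    mem_support_iff.1 hu (coeff_modMonomial_of_le F h)
  have hi' : i ∈ insert a s := hF <| (mem_vars_iff_mem_support i).2
    ⟨u, by rwa [mem_support_iff, coeff_modMonomial_of_not_le F hau, ← mem_support_iff] at hu, hiu⟩
  refine hi'.resolve_left ?_
  rintro rfl
  rw [Finsupp.single_le_iff] at hau
  exact hau (Nat.one_le_iff_ne_zero.2 (Finsupp.mem_support_iff.1 hiu))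

theorem quasiRegularOn_zero (y : σ → R) (s : Set σ) : QuasiRegularOn y s 0 := by
  intro F _ hF hy
  rw [← totalDegree_zero_iff_isHomogeneous, totalDegree_eq_zero_iff_eq_C] at hF
  rw [hF, eval_C] at hy
  rw [hF, hy]
  simp

theorem QuasiRegularOn.insert {y : σ → R} {s : Set σ} {a : σ} (h : ∀ d, QuasiRegularOn y s d)
    (ha : ∀ x, y a * x ∈ Ideal.span (y '' s) → x ∈ Ideal.span (y '' s)) (d : ℕ) :
    QuasiRegularOn y (insert a s) d := by
  induction d with
  | zero => exact quasiRegularOn_zero y _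
  | succ d ih =>
    intro F hFs hF hy
    have hle : Ideal.span (y '' s) ≤ Ideal.span (y '' Insert.insert a s) :=
      Ideal.span_mono (Set.image_mono (Set.subset_insert a s))
    have hya : y a ∈ Ideal.span (y '' Insert.insert a s) :=
      Ideal.subset_span ⟨a, Set.mem_insert a s, rfl⟩
    rw [← divMonomial_add_modMonomial_single F a] at hy ⊢
    have hHs := divMonomial_mem_supported hFs (Finsupp.single a 1)
    have hH := hF.divMonomial_single a
    have hGs := modMonomial_single_mem_supported hFs
    have hG := hF.modMonomial (Finsupp.single a 1)
    generalize F.divMonomial (Finsupp.single a 1) = H at *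
    generalize F.modMonomial (Finsupp.single a 1) = G at *
    rw [map_add, map_mul, eval_X] at hy
    have hHy : eval y H ∈ Ideal.span (y '' s) ^ (d + 1) := by
      refine mem_span_pow_of_mul_mem h ha ?_
      rw [eq_neg_of_add_eq_zero_left hy]
      exact neg_mem (hG.eval_mem_pow hGs)
    obtain ⟨P, hPs, hP, hPy⟩ := exists_form_of_mem_span_pow hHy
    have hGP := h (d + 1) (C (y a) * P + G)
      (add_mem (mul_mem (Subalgebra.algebraMap_mem _ (y a)) hPs) hGs) ((hP.C_mul _).add hG)
      (by simpa [hPy] using hy)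
    have hG' := sub_mem (Ideal.map_mono (f := (C : R →+* MvPolynomial σ R)) hle hGP)
      (Ideal.mul_mem_right P _ (Ideal.mem_map_of_mem C hya))
    rw [add_sub_cancel_left] at hG'
    exact add_mem (Ideal.mul_mem_left _ _
      (ih.mem_map_C hHs hH (Ideal.pow_right_mono hle _ hHy))) hG'

theorem quasiRegularOn_of_isWeaklyRegular {k : ℕ} {y : Fin k → R}
    (hy : RingTheory.Sequence.IsWeaklyRegular R (List.ofFn y)) (d : ℕ) :
    QuasiRegularOn y Set.univ d := by
  suffices h : ∀ m ≤ k, ∀ d, QuasiRegularOn y {i | i.val < m} d by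
    simpa using! h k le_rfl d
  intro m
  induction m with
  | zero =>
    intro _ d F hFs hF hFy
    have hC : F ∈ (⊥ : Subalgebra R (MvPolynomial (Fin k) R)) := by
      simpa using hFs
    obtain ⟨r, rfl⟩ := Algebra.mem_bot.1 hC
    have hr : r = 0 := by simpa [algebraMap_eq] using hFy
    simp [hr]
  | succ m ih =>
    intro hm
    have hset : {i : Fin k | i.val < m + 1} = Insert.insert ⟨m, hm⟩ {i | i.val < m} := by
      ext i
      simp [Fin.ext_iff, Nat.le_iff_lt_or_eq, or_comm]
    rw [hset]
    refine QuasiRegularOn.insert (ih (by omega)) fun x hx ↦ ?_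
    have hspan : Ideal.ofList ((List.ofFn y).take m) • (⊤ : Submodule R R) =
        Ideal.span (y '' {i | i.val < m}) := by
      rw [smul_eq_mul, Ideal.mul_top, Ideal.ofList]
      congr 1
      ext r
      simp [List.mem_take_iff_getElem, Fin.exists_iff]
      grind
    have := hy.regular_mod_prev m (by simpa using hm)
    rw [isSMulRegular_quotient_iff_mem_of_smul_mem, hspan] at this
    exact this x (by simpa using hx)

end MvPolynomial

theorem coeff_mem_pow_succ_of_mem_map_algebraMap {J : Ideal R} {z : reesAlgebra J}
    (hz : z ∈ J.map (algebraMap R (reesAlgebra J))) (n : ℕ) :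
    (z : R[X]).coeff n ∈ J ^ (n + 1) := by
  induction hz using Submodule.span_induction generalizing n with
  | mem x hx =>
    obtain ⟨a, ha, rfl⟩ := hx
    change (Polynomial.C a).coeff n ∈ _
    rw [Polynomial.coeff_C]
    split_ifs with h
    · subst h
      simpa using ha
    · exact zero_mem _
  | zero => simp
  | add x w _ _ hx hw => simpa using add_mem (hx n) (hw n)
  | smul c x _ hx =>
    rw [smul_eq_mul, MulMemClass.coe_mul, Polynomial.coeff_mul]
    refine sum_mem fun ij hij ↦ ?_
    rw [← Finset.HasAntidiagonal.mem_antidiagonal.1 hij, add_assoc, pow_add]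
    exact Ideal.mul_mem_mul (c.2 ij.1) (hx ij.2)

theorem coeff_aeval_C_mul_X {σ : Type*} (y : σ → R) (F : MvPolynomial σ R) (n : ℕ) :
    (MvPolynomial.aeval (fun i ↦ Polynomial.C (y i) * Polynomial.X) F).coeff n =
      MvPolynomial.eval y (MvPolynomial.homogeneousComponent n F) := by
  induction F using MvPolynomial.induction_on' with
  | monomial u r =>
    have hu := MvPolynomial.homogeneousComponent_of_mem (m := n)
      (MvPolynomial.isHomogeneous_monomial (d := u) r rfl)
    simp only [hu, MvPolynomial.aeval_monomial, mul_pow, Finsupp.prod_mul, ← map_pow,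
      Polynomial.algebraMap_eq, Polynomial.coeff_C_mul]
    simp only [Finsupp.prod, ← map_prod, Finset.prod_pow_eq_pow_sum, Polynomial.coeff_C_mul,
      Polynomial.coeff_X_pow, Finsupp.degree_apply]
    by_cases h : n = ∑ i ∈ u.support, u i <;> simp [h, MvPolynomial.eval_monomial, Finsupp.prod]
  | add p q hp hq => simp [hp, hq]

/-- The homogeneous presentation `R[t₁, …] → R[Jt]` sending `tᵢ` to `yᵢ·t`. -/
noncomputable def reesPresentation {σ : Type*} (J : Ideal R) (y : σ → R) (hy : ∀ i, y i ∈ J) :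
    MvPolynomial σ R →ₐ[R] reesAlgebra J :=
  MvPolynomial.aeval fun i ↦ reesDegOne J (y i) (hy i)

theorem coe_reesPresentation {σ : Type*} {J : Ideal R} {y : σ → R} (hy : ∀ i, y i ∈ J)
    (F : MvPolynomial σ R) :
    (reesPresentation J y hy F : R[X]) =
      MvPolynomial.aeval (fun i ↦ Polynomial.C (y i) * Polynomial.X) F := by
  change (reesAlgebra J).val (MvPolynomial.aeval _ F) = _
  rw [← AlgHom.comp_apply, MvPolynomial.comp_aeval]
  rfl

theorem reesPresentation_surjective {σ : Type*} {J : Ideal R} {y : σ → R} (hy : ∀ i, y i ∈ J)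
    (hJ : J = Ideal.span (Set.range y)) : Function.Surjective (reesPresentation J y hy) := by
  have hle : reesAlgebra J ≤ ((reesAlgebra J).val.comp (reesPresentation J y hy)).range := by
    refine (adjoin_monomial_eq_reesAlgebra J).symm.le.trans ?_
    refine Algebra.adjoin_le ?_
    have : Submodule.map (monomial 1 : R →ₗ[R] R[X]) J ≤
        ((reesAlgebra J).val.comp (reesPresentation J y hy)).range.toSubmodule := by
      rw [Submodule.map_le_iff_le_comap]
      nth_rw 1 [hJ]
      refine Submodule.span_le.2 ?_
      rintro _ ⟨i, rfl⟩
      refine ⟨MvPolynomial.X i, ?_⟩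
      simp [reesPresentation, reesDegOne, Polynomial.C_mul_X_eq_monomial]
    exact this
  intro z
  obtain ⟨F, hF⟩ := hle z.2
  exact ⟨F, Subtype.ext hF⟩

/-- Rees: let `y₁, …, y_k` be a regular sequence in a commutative
ring `R` generating a proper ideal `J`.  Then `gr_J(R) ≅ (R/J)[t₁, …, t_k]`,
with `t_i` corresponding to the image of `y_i` in `J/J²` (the class of the
degree-one element `y_i·t` of the Rees algebra), and `R/J` corresponding to the
degree-zero part. -/
theorem rees_assocGraded_iso_polynomial
    (kk : ℕ) (y : Fin kk → R)
    (hreg : RingTheory.Sequence.IsRegular R (List.ofFn y))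
    (J : Ideal R) (hJ : J = Ideal.span (Set.range y)) (hJproper : J ≠ ⊤) :
    ∃ e : MvPolynomial (Fin kk) (R ⧸ J) ≃+* assocGraded J,
      (∀ i : Fin kk,
        e (MvPolynomial.X i) =
          Ideal.Quotient.mk _ (reesDegOne J (y i)
            (by rw [hJ]; exact Ideal.subset_span ⟨i, rfl⟩))) ∧
      (∀ r : R,
        e (MvPolynomial.C (Ideal.Quotient.mk J r)) =
          Ideal.Quotient.mk _ (algebraMap R (reesAlgebra J) r)) := by
  
  have hy : ∀ i, y i ∈ J := fun i ↦ hJ ▸ Ideal.subset_span ⟨i, rfl⟩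
  have hspan : Ideal.span (y '' Set.univ) = J := by rw [Set.image_univ, hJ]
  let q : R →+* assocGraded J := (Ideal.Quotient.mk _).comp (algebraMap R (reesAlgebra J))
  let f : MvPolynomial (Fin kk) (R ⧸ J) →+* assocGraded J :=
    MvPolynomial.eval₂Hom
      (Ideal.Quotient.lift J q fun a ha ↦
        Ideal.Quotient.eq_zero_iff_mem.2 (Ideal.mem_map_of_mem _ ha))
      fun i ↦ Ideal.Quotient.mk _ (reesDegOne J (y i) (hy i))
  have hf (F : MvPolynomial (Fin kk) R) : f (MvPolynomial.map (Ideal.Quotient.mk J) F) =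
      Ideal.Quotient.mk _ (reesPresentation J y hy F) := by
    induction F using MvPolynomial.induction_on with
    | C r => simp [f, q, reesPresentation]
    | add p q hp hq => simp [hp, hq]
    | mul_X p i hp =>
      rw [map_mul, map_mul, hp, map_mul, map_mul]
      simp [f, reesPresentation]
  have hinj : Function.Injective f := by
    rw [injective_iff_map_eq_zero]
    intro p hp
    obtain ⟨F, rfl⟩ := MvPolynomial.map_surjective _ Ideal.Quotient.mk_surjective p
    rw [hf, Ideal.Quotient.eq_zero_iff_mem] at hp
    ext u
    have hcoeff := coeff_mem_pow_succ_of_mem_map_algebraMap hp u.degree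
    rw [coe_reesPresentation, coeff_aeval_C_mul_X] at hcoeff
    have hmem := (MvPolynomial.quasiRegularOn_of_isWeaklyRegular hreg.toIsWeaklyRegular
      u.degree).mem_map_C (by simp) (MvPolynomial.homogeneousComponent_isHomogeneous _ F)
      (by rwa [hspan])
    rw [hspan, MvPolynomial.mem_map_C_iff] at hmem
    simpa [MvPolynomial.coeff_homogeneousComponent, MvPolynomial.coeff_map,
      Ideal.Quotient.eq_zero_iff_mem] using hmem u
  have hsurj : Function.Surjective f := by
    intro z
    obtain ⟨w, rfl⟩ := Ideal.Quotient.mk_surjective z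
    obtain ⟨F, rfl⟩ := reesPresentation_surjective hy hJ w
    exact ⟨_, hf F⟩
  refine ⟨RingEquiv.ofBijective f ⟨hinj, hsurj⟩, fun i ↦ ?_, fun r ↦ ?_⟩
  · exact MvPolynomial.eval₂Hom_X' _ _ i
  · exact MvPolynomial.eval₂Hom_C _ _ _
end

section
/- Let R = k[x₁,...,x_n]/I be a positively graded k-algebra of Krull dimension d generated in degree 1 over k. Suppose for some A ⊂ [n] with |A| = d−1 the quotient R/⟨y_i : i ∈ A⟩ (y_i images of x_i) is isomorphic to the polynomial ring k[t], and the monomials in {y_i : i ∈ A} ∪ {t} form a homogeneous k-basis of R. Then the Hilbert function of R equals that of a polynomial ring in d variables, and I is generated by its degree 1 part; hence R is isomorphic to a polynomial ring. -/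
open MvPolynomial

/-- A surjective ring endomorphism of a Noetherian ring is injective. -/
lemma RingHom.injective_of_surjective_of_isNoetherianRing {R : Type*} [CommRing R]
    [IsNoetherianRing R] (f : R →+* R) (hf : Function.Surjective f) : Function.Injective f := by
  have hpow : ∀ n, ⇑(f ^ n) = f^[n] := fun n => RingHom.coe_pow f n
  let K : ℕ →o Ideal R :=
    ⟨fun n => RingHom.ker (f ^ n), monotone_nat_of_le_succ fun n x hx => by
      simp only [RingHom.mem_ker, hpow] at hx ⊢
      rw [Function.iterate_succ_apply', hx, map_zero]⟩
  obtain ⟨n, hn⟩ := monotone_stabilizes_iff_noetherian.2 (inferInstance : IsNoetherian R R) K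
  refine (injective_iff_map_eq_zero f).2 fun x hx => ?_
  obtain ⟨z, rfl⟩ := hf.iterate n x
  have hz : z ∈ K (n + 1) := by
    change (f ^ (n + 1)) z = 0
    rwa [hpow, Function.iterate_succ_apply']
  rw [← hn (n + 1) n.le_succ] at hz
  change (f ^ n) z = 0 at hz
  rwa [hpow] at hz

namespace MvPolynomial

variable {σ ι k : Type*}

/-- If `b` has no constant term, the linear part of `a * b` is the constant term of `a` times
the linear part of `b`. -/
lemma homogeneousComponent_one_mul [CommSemiring k] (a b : MvPolynomial σ k)
    (hb : constantCoeff b = 0) :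
    homogeneousComponent 1 (a * b) = C (constantCoeff a) * homogeneousComponent 1 b := by
  classical
  ext m
  rw [coeff_C_mul, coeff_homogeneousComponent, coeff_homogeneousComponent]
  split_ifs with hm
  · obtain ⟨s, rfl⟩ := (Finsupp.sum_eq_one_iff m).1 hm
    rw [coeff_mul, Finsupp.antidiagonal_single]
    rw [constantCoeff_eq] at hb
    simp [Finset.Nat.antidiagonal_succ, hb, constantCoeff_eq]
  · simp

/-- The linear part of a substitution without constant terms is obtained by substituting the
linear parts into the linear part. -/
lemma homogeneousComponent_one_aeval [CommRing k] (w : ι → MvPolynomial σ k)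
    (hw : ∀ i, constantCoeff (w i) = 0) (p : MvPolynomial ι k) :
    homogeneousComponent 1 (aeval w p) =
      aeval (fun i => homogeneousComponent 1 (w i)) (homogeneousComponent 1 p) := by
  have hcc : ∀ p : MvPolynomial ι k, constantCoeff (aeval w p) = constantCoeff p := by
    intro p
    induction p using MvPolynomial.induction_on with
    | C a => simp
    | add p q hp hq => rw [map_add, map_add, hp, hq, map_add]
    | mul_X p i _ => simp [hw]
  induction p using MvPolynomial.induction_on with
  | C a =>
    rw [aeval_C, algebraMap_eq, homogeneousComponent_of_mem (isHomogeneous_C _ a),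
      homogeneousComponent_of_mem (isHomogeneous_C _ a)]
    simp
  | add p q hp hq => simp only [map_add, hp, hq]
  | mul_X p i _ =>
    rw [map_mul, aeval_X, homogeneousComponent_one_mul _ _ (hw i),
      homogeneousComponent_one_mul _ _ (constantCoeff_X _ i),
      homogeneousComponent_of_mem (isHomogeneous_X k i), hcc]
    simp

/-- If the quotient by a homogeneous ideal is a polynomial ring, then linear forms can be chosen
as coordinates, and the variables are linear forms in those coordinates modulo the ideal. -/
lemma exists_linear_coordinates [CommRing k] (I : Ideal (MvPolynomial σ k))
    (hI : ∀ f ∈ I, ∀ e : ℕ, homogeneousComponent e f ∈ I)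
    (φ : MvPolynomial ι k ≃ₐ[k] MvPolynomial σ k ⧸ I) :
    ∃ (T : ι → MvPolynomial σ k) (L : σ → MvPolynomial ι k),
      (∀ i, (T i).IsHomogeneous 1) ∧ (∀ j, (L j).IsHomogeneous 1) ∧
      ∀ j, X j - aeval T (L j) ∈ I := by
  choose w hw using fun i => Ideal.Quotient.mkₐ_surjective k I (φ (X i))
  let c : ι → k := fun i => constantCoeff (w i)
  let v : ι → MvPolynomial σ k := fun i => w i - C (c i)
  let p : σ → MvPolynomial ι k := fun j =>
    aeval (fun i => X i + C (c i)) (φ.symm (Ideal.Quotient.mkₐ k I (X j)))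
  refine ⟨fun i => homogeneousComponent 1 (v i), fun j => homogeneousComponent 1 (p j),
    fun i => homogeneousComponent_isHomogeneous _ _,
    fun j => homogeneousComponent_isHomogeneous _ _, fun j => ?_⟩
  have hφ : (Ideal.Quotient.mkₐ k I).comp (aeval w) = φ.toAlgHom := by
    ext i
    simpa using hw i
  have hv : (aeval v).comp (aeval fun i => X i + C (c i)) = aeval (R := k) w := by
    ext1 i
    simp [v]
  have hmem : X j - aeval v (p j) ∈ I := by
    rw [← Ideal.Quotient.mk_eq_mk_iff_sub_mem]
    have h1 := DFunLike.congr_fun hv (φ.symm (Ideal.Quotient.mkₐ k I (X j)))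
    have h2 := DFunLike.congr_fun hφ (φ.symm (Ideal.Quotient.mkₐ k I (X j)))
    rw [← hv] at h2
    simpa [p] using h2.symm
  have h := hI _ hmem 1
  rwa [map_sub, homogeneousComponent_of_mem (isHomogeneous_X k j), if_pos rfl,
    homogeneousComponent_one_aeval v (fun i => by simp [v, c])] at h

/-- A monomial basis in the elements `u i` and `t` identifies an algebra with a polynomial ring. -/
lemma nonempty_algEquiv_of_monomial_basis [Field k] [Fintype ι] {R : Type*} [CommRing R]
    [Algebra k R] (u : ι → R) (t : R)
    (hli : LinearIndependent k (fun p : (ι → ℕ) × ℕ => (∏ i, u i ^ p.1 i) * t ^ p.2))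
    (hsp : ⊤ ≤ Submodule.span k
      (Set.range (fun p : (ι → ℕ) × ℕ => (∏ i, u i ^ p.1 i) * t ^ p.2))) :
    Nonempty (MvPolynomial (Option ι) k ≃ₐ[k] R) := by
  let e : (Option ι →₀ ℕ) ≃ (ι → ℕ) × ℕ :=
    Finsupp.equivFunOnFinite.trans (Equiv.piOptionEquivProd.trans (Equiv.prodComm _ _))
  let E := (basisMonomials (Option ι) k).equiv (Module.Basis.mk hli hsp) e
  let ψ : MvPolynomial (Option ι) k →ₐ[k] R := aeval (fun o => o.elim t u)
  have hE : E.toLinearMap = ψ.toLinearMap := by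
    refine (basisMonomials (Option ι) k).ext fun m => ?_
    rw [LinearEquiv.coe_coe, Module.Basis.equiv_apply]
    simp [ψ, aeval_monomial, Finsupp.prod_fintype, e, mul_comm, Equiv.piOptionEquivProd]
  have hb : Function.Bijective ψ := by
    have h : (ψ : MvPolynomial (Option ι) k → R) = E :=
      by
      funext x
      exact (LinearMap.congr_fun hE x).symm
    rw [h]
    exact E.bijective
  exact ⟨AlgEquiv.ofBijective ψ hb⟩

end MvPolynomial

/-- A homogeneous ideal whose quotient is a polynomial ring is generated by linear forms, and
its quotient has the Hilbert function of that polynomial ring. -/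
lemma hilbert_eq_and_eq_span_linear_of_algEquiv
    {σ ι k : Type*} [Field k] [Finite ι] (I : Ideal (MvPolynomial σ k))
    (hI : ∀ f ∈ I, ∀ e : ℕ, homogeneousComponent e f ∈ I)
    (φ : MvPolynomial ι k ≃ₐ[k] MvPolynomial σ k ⧸ I) :
    (∀ m : ℕ,
      Module.finrank k
        (Submodule.map (Ideal.Quotient.mkₐ k I).toLinearMap (homogeneousSubmodule σ k m)) =
      Module.finrank k (homogeneousSubmodule ι k m)) ∧
    I = Ideal.span {p | p ∈ I ∧ p.IsHomogeneous 1} := by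
  obtain ⟨T, L, hT, hL, hTL⟩ := exists_linear_coordinates I hI φ
  have haT : ∀ {m : ℕ} {g : MvPolynomial ι k}, g.IsHomogeneous m →
      (aeval T g).IsHomogeneous m := fun {m g} hg => by
    simpa using hg.aeval T hT
  have haL : ∀ {m : ℕ} {f : MvPolynomial σ k}, f.IsHomogeneous m →
      (aeval L f).IsHomogeneous m := fun {m f} hf => by
    simpa using hf.aeval L hL
  let ψ : MvPolynomial ι k →ₐ[k] MvPolynomial σ k ⧸ I :=
    (Ideal.Quotient.mkₐ k I).comp (aeval T)
  have hψL : ∀ f, ψ (aeval L f) = Ideal.Quotient.mkₐ k I f := by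
    intro f
    refine DFunLike.congr_fun (f := ψ.comp (aeval L)) (g := Ideal.Quotient.mkₐ k I) ?_ f
    ext j
    simpa [ψ] using ((Ideal.Quotient.mk_eq_mk_iff_sub_mem _ _).2 (hTL j)).symm
  have hsurj : Function.Surjective ψ := fun r => by
    obtain ⟨f, rfl⟩ := Ideal.Quotient.mkₐ_surjective k I r
    exact ⟨_, hψL f⟩
  have hinj : Function.Injective ψ := by
    have h := RingHom.injective_of_surjective_of_isNoetherianRing
      (φ.symm.toAlgHom.comp ψ).toRingHom (φ.symm.surjective.comp hsurj)
    exact Function.Injective.of_comp (f := φ.symm) h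
  constructor
  · intro m
    have himage : Submodule.map (Ideal.Quotient.mkₐ k I).toLinearMap
        (homogeneousSubmodule σ k m) =
        Submodule.map ψ.toLinearMap (homogeneousSubmodule ι k m) := by
      apply le_antisymm
      · rintro _ ⟨f, hf, rfl⟩
        exact ⟨aeval L f, haL hf, hψL f⟩
      · rintro _ ⟨g, hg, rfl⟩
        exact ⟨aeval T g, haT hg, rfl⟩
    rw [himage]
    exact (Submodule.equivMapOfInjective ψ.toLinearMap hinj _).finrank_eq.symm
  · refine le_antisymm (fun f hf => ?_) (Ideal.span_le.2 fun p hp => hp.1)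
    set J := Ideal.span {p | p ∈ I ∧ p.IsHomogeneous 1}
    have hcongr : Ideal.Quotient.mkₐ k J (aeval T (aeval L f)) = Ideal.Quotient.mkₐ k J f := by
      refine DFunLike.congr_fun (f := ((Ideal.Quotient.mkₐ k J).comp (aeval T)).comp (aeval L))
        (g := Ideal.Quotient.mkₐ k J) ?_ f
      ext j
      have hj : X j - aeval T (L j) ∈ J :=
        Ideal.subset_span ⟨hTL j, (isHomogeneous_X k j).sub (haT (hL j))⟩
      simpa using ((Ideal.Quotient.mk_eq_mk_iff_sub_mem _ _).2 hj).symm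
    have hzero : aeval L f = 0 := by
      apply hinj
      rw [hψL, map_zero]
      exact Ideal.Quotient.eq_zero_iff_mem.2 hf
    rw [hzero, map_zero, map_zero] at hcongr
    exact Ideal.Quotient.eq_zero_iff_mem.1 hcongr.symm

/-- let `R = k[x₁,…,x_n]/I` be a positively graded `k`-algebra of
Krull dimension `d`, generated in degree `1`.  Suppose that for some `A ⊆ [n]`
with `|A| = d - 1` the quotient `R/⟨y_i : i ∈ A⟩` (where `y_i` is the image of
`x_i`) is isomorphic to the polynomial ring `k[t]`, and that the monomials in
`{y_i : i ∈ A} ∪ {t}` form a (homogeneous) `k`-basis of `R`.  Then the Hilbert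
function of `R` equals that of a polynomial ring in `d` variables, `I` is
generated by its degree-one part, and `R` is isomorphic to a polynomial ring. -/
theorem linear_of_prime_codim_one_cone
    {k : Type*} [Field k] {n : ℕ}
    (I : Ideal (MvPolynomial (Fin n) k))
    (hI : ∀ f ∈ I, ∀ e : ℕ, homogeneousComponent e f ∈ I)
    (d : ℕ) (hd1 : 1 ≤ d)
    (hdim : ringKrullDim (MvPolynomial (Fin n) k ⧸ I) = d)
    (A : Finset (Fin n)) (hA : A.card = d - 1)
    (y : Fin n → MvPolynomial (Fin n) k ⧸ I)
    (hy : y = fun i => Ideal.Quotient.mk I (X i))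
    (hquot : Nonempty
      (((MvPolynomial (Fin n) k ⧸ I) ⧸ Ideal.span (y '' (A : Set (Fin n)))) ≃ₐ[k]
        Polynomial k))
    (t : MvPolynomial (Fin n) k ⧸ I)
    (hbasis :
      LinearIndependent k
        (fun p : ({i // i ∈ A} → ℕ) × ℕ =>
          (∏ i : {i // i ∈ A}, y i.1 ^ p.1 i) * t ^ p.2) ∧
      ⊤ ≤ Submodule.span k
        (Set.range (fun p : ({i // i ∈ A} → ℕ) × ℕ =>
          (∏ i : {i // i ∈ A}, y i.1 ^ p.1 i) * t ^ p.2))) :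
    (∀ m : ℕ,
      Module.finrank k
        (Submodule.map (Ideal.Quotient.mkₐ k I).toLinearMap
          (homogeneousSubmodule (Fin n) k m)) =
      Module.finrank k (homogeneousSubmodule (Fin d) k m)) ∧
    I = Ideal.span {p | p ∈ I ∧ p.IsHomogeneous 1} ∧
    Nonempty ((MvPolynomial (Fin n) k ⧸ I) ≃ₐ[k] MvPolynomial (Fin d) k) := by
  obtain ⟨φ⟩ := nonempty_algEquiv_of_monomial_basis
    (fun i : {i // i ∈ A} => y i.1) t hbasis.1 hbasis.2
  have hcard : Fintype.card (Option {i // i ∈ A}) = d := by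
    simp only [Fintype.card_option, Fintype.card_coe]
    omega
  let φ' := (renameEquiv k (Fintype.equivFinOfCardEq hcard)).symm.trans φ
  obtain ⟨h1, h2⟩ := hilbert_eq_and_eq_span_linear_of_algEquiv I hI φ'
  exact ⟨h1, h2, ⟨φ'.symm⟩⟩
end
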